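/- Let n ≥ 1 be an integer and let p ≥ 1, α > 0, β > 0 and A > 0 be real numbers. Then there exists a globally defined function f : [0,∞) → ℝ with f ∈ C¹([0,∞)) ∩ C²((0,∞)), f(0) = A and f'(0) = 0, which satisfies f(ξ)^p (f''(ξ) + (n−1)ξ^{−1} f'(ξ)) + β ξ f'(ξ) + α f(ξ) = 0 for all ξ > 0, and moreover f(ξ) > 0 and f'(ξ) ≤ 0 for all ξ ≥ 0. -/

import Mathlib

noncomputable section

/-- A continuous function starting nonpositive, whose derivative is nonpositive wherever the
function is positive, stays nonpositive. -/
theorem nonpos_of_deriv_nonpos_of_pos {φ φ' : ℝ → ℝ} {a b : ℝ} (hab : a ≤ b)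
    (hc : ContinuousOn φ (Set.Icc a b)) (ha : φ a ≤ 0)
    (hd : ∀ x ∈ Set.Ioo a b, 0 < φ x → HasDerivAt φ (φ' x) x ∧ φ' x ≤ 0) : φ b ≤ 0 := by
  by_contra! hb
  have hcl : IsCompact (Set.Icc a b ∩ φ ⁻¹' Set.Iic 0) :=
    isCompact_Icc.of_isClosed_subset (hc.preimage_isClosed_of_isClosed isClosed_Icc isClosed_Iic)
      Set.inter_subset_left
  obtain ⟨c, ⟨hc1, hc2⟩, hmax⟩ := hcl.exists_isGreatest ⟨a, ⟨le_rfl, hab⟩, ha⟩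
  have hpos : ∀ x ∈ Set.Ioo c b, 0 < φ x := by
    intro x hx
    by_contra! hx0
    exact absurd (hmax ⟨⟨hc1.1.trans hx.1.le, hx.2.le⟩, hx0⟩) (not_le.2 hx.1)
  have hD : ∀ x ∈ Set.Ioo c b, HasDerivAt φ (φ' x) x ∧ φ' x ≤ 0 := fun x hx =>
    hd x ⟨hc1.1.trans_lt hx.1, hx.2⟩ (hpos x hx)
  have hanti : AntitoneOn φ (Set.Icc c b) := by
    apply antitoneOn_of_deriv_nonpos (convex_Icc c b)
      (hc.mono (Set.Icc_subset_Icc hc1.1 le_rfl))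
    · intro x hx
      rw [interior_Icc] at hx
      exact (hD x hx).1.differentiableAt.differentiableWithinAt
    · intro x hx
      rw [interior_Icc] at hx
      rw [(hD x hx).1.deriv]
      exact (hD x hx).2
  have := hanti ⟨le_rfl, hc1.2⟩ ⟨hc1.2, le_rfl⟩ hc1.2
  have h2 : φ c ≤ 0 := hc2
  linarith

theorem mul_integral_pow_mul_comp_eq (n : ℕ) (k : ℝ → ℝ) {s : ℝ} (hs : 0 < s) :
    s * ∫ t in (0:ℝ)..1, t ^ n * k (t * s) = (s ^ n)⁻¹ * ∫ r in (0:ℝ)..s, r ^ n * k r := by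
  have h := intervalIntegral.mul_integral_comp_mul_right (a := 0) (b := 1)
    (f := fun r => r ^ n * k r) s
  simp only [zero_mul, one_mul] at h
  have e : ∀ t : ℝ, t ^ n * k (t * s) = (s ^ n)⁻¹ * ((t * s) ^ n * k (t * s)) := fun t => by
    rw [mul_pow]
    field_simp
  rw [intervalIntegral.integral_congr fun t _ => e t, intervalIntegral.integral_const_mul, ← h,
    mul_left_comm]

/-- The radial average of a continuous function satisfies a first order singular linear ODE. -/
theorem hasDerivAt_of_eq_mul_integral (n : ℕ) {k g : ℝ → ℝ} (hk : Continuous k)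
    (hg : ∀ s, 0 ≤ s → g s = -(s * ∫ t in (0:ℝ)..1, t ^ n * k (t * s))) {s : ℝ} (hs : 0 < s) :
    HasDerivAt g (-(n * s⁻¹ * g s) - k s) s := by
  have hc : Continuous fun r : ℝ => r ^ n * k r := by fun_prop
  have hI : HasDerivAt (fun x => ∫ r in (0:ℝ)..x, r ^ n * k r) (s ^ n * k s) s :=
    intervalIntegral.integral_hasDerivAt_right (hc.intervalIntegrable _ _)
      (hc.stronglyMeasurableAtFilter _ _) hc.continuousAt
  have hP : HasDerivAt (fun x : ℝ => (x ^ n)⁻¹) (-(n * s ^ (n - 1)) / (s ^ n) ^ 2) s :=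
    (hasDerivAt_pow n s).inv (by positivity)
  have hm := (hP.mul hI).neg
  have heq : g =ᶠ[nhds s] -((fun x : ℝ => (x ^ n)⁻¹) * fun x => ∫ r in (0:ℝ)..x, r ^ n * k r) := by
    filter_upwards [lt_mem_nhds hs] with x hx
    rw [hg x hx.le, mul_integral_pow_mul_comp_eq n k hx]
    rfl
  refine (hm.congr_of_eventuallyEq heq).congr_deriv ?_
  rw [hg s hs.le, mul_integral_pow_mul_comp_eq n k hs]
  rcases n with _ | n
  · simp
  · have : s ^ (n + 1) ≠ 0 := by positivity
    simp only [Nat.add_sub_cancel]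
    field_simp
    ring

/-- Global solvability of `f'' + (n / s) f' + h s f f' = 0`, `f 0 = A`, `f' 0 = 0`, in integrated
form, for a bounded Lipschitz nonlinearity with constants depending on `s`. -/
theorem exists_radial_solution (n : ℕ) (A : ℝ) (h : ℝ → ℝ → ℝ → ℝ)
    (hc : Continuous fun q : ℝ × ℝ × ℝ => h q.1 q.2.1 q.2.2) (l : ℝ → ℝ) (hl : Continuous l)
    (hl1 : ∀ s, 0 ≤ s → 1 ≤ l s) (hb : ∀ s, 0 ≤ s → ∀ x y, |h s x y| ≤ l s)
    (hL : ∀ s, 0 ≤ s → ∀ x y x' y',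
      |h s x y - h s x' y'| ≤ l s / 4 * (|x - x'| + |y - y'|)) :
    ∃ f g : ℝ → ℝ, Continuous g ∧ f 0 = A ∧ (∀ s, HasDerivAt f (g s) s) ∧
      ∀ s, 0 ≤ s →
        g s = -(s * ∫ t in (0:ℝ)..1, t ^ n * h (t * s) (f (t * s)) (g (t * s))) := by
  have prim : ∀ {u : ℝ → ℝ}, Continuous u → ∀ s,
      HasDerivAt (fun x => ∫ r in (0:ℝ)..x, u r) (u s) s := fun hu s =>
    intervalIntegral.integral_hasDerivAt_right (hu.intervalIntegrable _ _)
      (hu.stronglyMeasurableAtFilter _ _) hu.continuousAt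
  set W : ℝ → ℝ := fun s => Real.exp (∫ r in (0:ℝ)..s, l r) with hW
  have hWd : ∀ s, HasDerivAt W (l s * W s) s := fun s => by
    have := (prim hl s).exp
    rwa [mul_comm] at this
  have hWc : Continuous W := continuous_iff_continuousAt.2 fun s => (hWd s).continuousAt
  have hWp : ∀ s, 0 < W s := fun s => Real.exp_pos _
  have hW1 : ∀ s, 0 ≤ s → 1 ≤ W s := fun s hs => by
    refine Real.one_le_exp (intervalIntegral.integral_nonneg hs fun u hu => ?_)
    linarith [hl1 u hu.1]
  have hlW : Continuous fun s => l s * W s := hl.mul hWc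
  have hWint : ∀ s, ∫ r in (0:ℝ)..s, l r * W r = W s - 1 := fun s => by
    rw [intervalIntegral.integral_eq_sub_of_hasDerivAt (fun x _ => hWd x)
      (hlW.intervalIntegrable _ _)]
    simp [hW]
  have key : ∀ (k : ℝ → ℝ) (C : ℝ), Continuous k → 0 ≤ C →
      (∀ s, 0 ≤ s → |k s| ≤ C * (l s * W s)) → ∀ s, 0 ≤ s →
      |s * ∫ t in (0:ℝ)..1, t ^ n * k (t * s)| ≤ C * W s := by
    intro k C hk hC hkb s hs
    rw [abs_mul, abs_of_nonneg hs]
    have h1 : |∫ t in (0:ℝ)..1, t ^ n * k (t * s)| ≤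
        ∫ t in (0:ℝ)..1, C * (l (t * s) * W (t * s)) := by
      rw [← Real.norm_eq_abs]
      refine intervalIntegral.norm_integral_le_of_norm_le zero_le_one
        (MeasureTheory.ae_of_all _ fun t ht => ?_)
        ((by fun_prop : Continuous fun t : ℝ =>
          C * (l (t * s) * W (t * s))).intervalIntegrable _ _)
      rw [Real.norm_eq_abs, abs_mul, abs_of_nonneg (pow_nonneg ht.1.le n)]
      calc t ^ n * |k (t * s)| ≤ 1 * |k (t * s)| := by
            gcongr
            exact pow_le_one₀ ht.1.le ht.2
        _ ≤ _ := by rw [one_mul]; exact hkb _ (mul_nonneg ht.1.le hs)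
    have h2 := intervalIntegral.mul_integral_comp_mul_right (a := 0) (b := 1)
      (f := fun r => C * (l r * W r)) s
    simp only [zero_mul, one_mul] at h2
    calc s * |∫ t in (0:ℝ)..1, t ^ n * k (t * s)|
        ≤ s * ∫ t in (0:ℝ)..1, C * (l (t * s) * W (t * s)) := by gcongr
      _ = C * (W s - 1) := by rw [h2, intervalIntegral.integral_const_mul, hWint]
      _ ≤ C * W s := by nlinarith
  let F : (BoundedContinuousFunction ℝ ℝ) → ℝ → ℝ := fun G s => A + ∫ r in (0:ℝ)..s, W r * G r
  have hWG : ∀ G : BoundedContinuousFunction ℝ ℝ, Continuous fun r => W r * G r :=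
    fun G => hWc.mul G.continuous
  have hFd : ∀ G s, HasDerivAt (F G) (W s * G s) s := fun G s => (prim (hWG G) s).const_add A
  have hFc : ∀ G, Continuous (F G) := fun G =>
    continuous_iff_continuousAt.2 fun s => (hFd G s).continuousAt
  let K : (BoundedContinuousFunction ℝ ℝ) → ℝ → ℝ := fun G s => h s (F G s) (W s * G s)
  have hKc : ∀ G, Continuous (K G) := fun G =>
    hc.comp (continuous_id.prodMk ((hFc G).prodMk (hWG G)))
  let T₀ : (BoundedContinuousFunction ℝ ℝ) → ℝ → ℝ := fun G s =>
    -((W (max s 0))⁻¹ * (max s 0 * ∫ t in (0:ℝ)..1, t ^ n * K G (t * max s 0)))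
  have hTc : ∀ G, Continuous (T₀ G) := by
    intro G
    have := hKc G
    have h1 : Continuous fun s : ℝ => ∫ t in (0:ℝ)..1, t ^ n * K G (t * max s 0) := by
      apply intervalIntegral.continuous_parametric_intervalIntegral_of_continuous'
      fun_prop
    have h2 : Continuous fun s : ℝ => (W (max s 0))⁻¹ :=
      (hWc.comp (by fun_prop)).inv₀ fun s => (hWp _).ne'
    exact (h2.mul ((by fun_prop : Continuous fun s : ℝ => max s 0).mul h1)).neg
  have hTb : ∀ G s, ‖T₀ G s‖ ≤ 1 := by
    intro G s
    have hm : 0 ≤ max s 0 := le_max_right _ _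
    have := key (K G) 1 (hKc G) zero_le_one (fun s hs => by
      have h1 := hb s hs (F G s) (W s * G s)
      have h2 := hl1 s hs
      have h3 := hW1 s hs
      rw [one_mul]
      exact h1.trans (le_mul_of_one_le_right (by linarith) h3)) _ hm
    simp only [T₀, norm_neg, Real.norm_eq_abs]
    rw [abs_mul, abs_inv, abs_of_pos (hWp _), inv_mul_le_iff₀ (hWp _)]
    linarith
  let T : BoundedContinuousFunction ℝ ℝ → BoundedContinuousFunction ℝ ℝ := fun G =>
    BoundedContinuousFunction.ofNormedAddCommGroup (T₀ G) (hTc G) 1 (hTb G)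
  have hT : ContractingWith (1 / 2) T := by
    refine ⟨by rw [← NNReal.coe_lt_coe]; norm_num, LipschitzWith.of_dist_le_mul fun G G' => ?_⟩
    rw [BoundedContinuousFunction.dist_le (by positivity)]
    intro s
    have hGG : ∀ r, |G r - G' r| ≤ dist G G' := fun r => by
      rw [← Real.dist_eq]
      exact BoundedContinuousFunction.dist_coe_le_dist r
    have hd0 : 0 ≤ dist G G' := dist_nonneg
    have hWGd : ∀ r, |W r * G r - W r * G' r| ≤ W r * dist G G' := fun r => by
      rw [← mul_sub, abs_mul, abs_of_pos (hWp r)]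
      exact mul_le_mul_of_nonneg_left (hGG r) (hWp r).le
    have hFF : ∀ r, 0 ≤ r → |F G r - F G' r| ≤ W r * dist G G' := by
      intro r hr
      have e : F G r - F G' r = ∫ q in (0:ℝ)..r, (W q * G q - W q * G' q) := by
        rw [intervalIntegral.integral_sub ((hWG G).intervalIntegrable _ _)
          ((hWG G').intervalIntegrable _ _)]
        simp only [F]
        ring
      rw [e]
      calc |∫ q in (0:ℝ)..r, (W q * G q - W q * G' q)|
          ≤ ∫ q in (0:ℝ)..r, dist G G' * (l q * W q) := by
            rw [← Real.norm_eq_abs]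
            refine intervalIntegral.norm_integral_le_of_norm_le hr
              (MeasureTheory.ae_of_all _ fun t ht => ?_)
              ((hlW.const_mul _).intervalIntegrable _ _)
            refine (hWGd t).trans ?_
            rw [mul_comm]
            gcongr
            exact le_mul_of_one_le_left (hWp t).le (hl1 t ht.1.le)
        _ = dist G G' * (W r - 1) := by rw [intervalIntegral.integral_const_mul, hWint]
        _ ≤ W r * dist G G' := by nlinarith
    have hm : 0 ≤ max s 0 := le_max_right _ _
    have := key (fun r => K G r - K G' r) (dist G G' / 2) ((hKc G).sub (hKc G'))
      (by positivity) (fun r hr => by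
        refine (hL r hr _ _ _ _).trans ?_
        have h1 := hFF r hr
        have h2 := hWGd r
        have h3 := hl1 r hr
        calc l r / 4 * (|F G r - F G' r| + |W r * G r - W r * G' r|)
            ≤ l r / 4 * (W r * dist G G' + W r * dist G G') := by gcongr
          _ = _ := by ring) _ hm
    have e : T G s - T G' s = -((W (max s 0))⁻¹ *
        (max s 0 * ∫ t in (0:ℝ)..1, t ^ n * (K G (t * max s 0) - K G' (t * max s 0)))) := by
      have h1 := hKc G
      have h2 := hKc G'
      simp only [mul_sub]
      rw [intervalIntegral.integral_sub (Continuous.intervalIntegrable (by fun_prop) _ _)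
        (Continuous.intervalIntegrable (by fun_prop) _ _)]
      simp only [T, T₀, BoundedContinuousFunction.coe_ofNormedAddCommGroup]
      ring
    rw [Real.dist_eq, e, abs_neg, abs_mul, abs_inv, abs_of_pos (hWp _), inv_mul_le_iff₀ (hWp _)]
    refine this.trans (le_of_eq ?_)
    push_cast
    ring
  set G := hT.fixedPoint T
  have hG : T G = G := hT.fixedPoint_isFixedPt
  refine ⟨F G, fun s => W s * G s, hWG G, by simp [F], hFd G, fun s hs => ?_⟩
  have e : G s = T₀ G s := by 
    conv_lhs => rw [← hG]
    rfl
  show W s * G s = _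
  rw [e]
  simp only [T₀, max_eq_left hs]
  have := (hWp s).ne'
  field_simp
  rfl

theorem abs_max_min_sub_max_min_le (a b x y : ℝ) :
    |max a (min x b) - max a (min y b)| ≤ |x - y| := by
  have h1 := abs_max_sub_max_le_max a (min x b) a (min y b)
  have h2 := abs_min_sub_min_le_max x b y b
  simp only [sub_self, abs_zero, abs_nonneg, max_eq_left, max_eq_right] at h1 h2
  exact h1.trans h2

theorem abs_rpow_neg_sub_rpow_neg_le {p d x y : ℝ} (hp : 0 ≤ p) (hd : 0 < d) (hx : d ≤ x)
    (hy : d ≤ y) : |x ^ (-p) - y ^ (-p)| ≤ p * d ^ (-p - 1) * |x - y| := by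
  refine (convex_Ici d).norm_image_sub_le_of_norm_hasDerivWithin_le
    (f := fun z : ℝ => z ^ (-p)) (f' := fun z : ℝ => -p * z ^ (-p - 1))
    (fun z hz => ?_) (fun z hz => ?_) (Set.mem_Ici.2 hy) (Set.mem_Ici.2 hx)
  · exact (Real.hasDerivAt_rpow_const (Or.inl (hd.trans_le hz).ne')).hasDerivWithinAt
  · have hz0 : 0 < z := hd.trans_le hz
    rw [Real.norm_eq_abs, abs_mul, abs_neg, abs_of_nonneg hp,
      abs_of_nonneg (Real.rpow_nonneg hz0.le _)]
    exact mul_le_mul_of_nonneg_left (Real.rpow_le_rpow_of_nonpos hd hz (by linarith)) hp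

/-- Solution of the profile equation in which `f` is truncated below by the barrier `δ`. -/
theorem exists_truncated_profile (n : ℕ) {p α β A : ℝ} (hp : 1 ≤ p) (hα : 0 < α) (hβ : 0 < β)
    (hA : 0 < A) {δ : ℝ → ℝ} (hδc : Continuous δ) (hδa : Antitone δ) (hδ0 : ∀ s, 0 < δ s)
    (hδA : ∀ s, δ s ≤ A) :
    ∃ f g : ℝ → ℝ, Continuous g ∧ f 0 = A ∧ (∀ s, HasDerivAt f (g s) s) ∧
      (∀ s, 0 ≤ s → -(α * s * δ s ^ (1 - p)) ≤ g s ∧ g s ≤ 0 ∧ f s ≤ A) ∧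
      ∀ s, 0 < s → δ s ≤ f s →
        HasDerivAt g (-(n * s⁻¹ * g s) - f s ^ (-p) * (β * s * g s + α * f s)) s := by
  let M : ℝ → ℝ := fun s => α * s * δ s ^ (1 - p)
  let m : ℝ → ℝ → ℝ := fun s x => max (δ s) (min x A)
  let c : ℝ → ℝ → ℝ := fun s y => max (-M s) (min y 0)
  let h : ℝ → ℝ → ℝ → ℝ := fun s x y => m s x ^ (-p) * (β * s * c s y + α * m s x)
  let E : ℝ → ℝ := fun s => β * s * M s + α * A
  let l : ℝ → ℝ := fun s => 1 + δ s ^ (-p) * E s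
    + 4 * (p * δ s ^ (-p - 1) * E s + δ s ^ (-p) * (β * s + α))
  have hδr : ∀ q : ℝ, Continuous fun s => δ s ^ q := fun q =>
    hδc.rpow_const fun s => Or.inl (hδ0 s).ne'
  have hMc : Continuous M := (continuous_const.mul continuous_id).mul (hδr _)
  have hEc : Continuous E := by fun_prop
  have hlc : Continuous l := by
    have h1 := hδr (-p)
    have h2 := hδr (-p - 1)
    fun_prop
  have hmδ : ∀ s x, δ s ≤ m s x := fun s x => le_max_left _ _
  have hm0 : ∀ s x, 0 < m s x := fun s x => (hδ0 s).trans_le (hmδ s x)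
  have hmA : ∀ s x, m s x ≤ A := fun s x => max_le (hδA s) (min_le_right _ _)
  have hM0 : ∀ s, 0 ≤ s → 0 ≤ M s := fun s hs =>
    mul_nonneg (mul_nonneg hα.le hs) (Real.rpow_nonneg (hδ0 s).le _)
  have hcM : ∀ s y, -M s ≤ c s y := fun s y => le_max_left _ _
  have hc0 : ∀ s, 0 ≤ s → ∀ y, c s y ≤ 0 := fun s hs y =>
    max_le (by linarith [hM0 s hs]) (min_le_right _ _)
  have hmr : ∀ s x, m s x ^ (-p) ≤ δ s ^ (-p) := fun s x =>
    Real.rpow_le_rpow_of_nonpos (hδ0 s) (hmδ s x) (by linarith)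
  have hmr0 : ∀ s x, 0 < m s x ^ (-p) := fun s x => Real.rpow_pos_of_pos (hm0 s x) _
  have hE0 : ∀ s, 0 ≤ s → 0 ≤ E s := fun s hs => by
    have := hM0 s hs
    positivity
  have hin : ∀ s, 0 ≤ s → ∀ x y, |β * s * c s y + α * m s x| ≤ E s := by
    intro s hs x y
    have h1 : β * s * c s y ≤ 0 := mul_nonpos_of_nonneg_of_nonpos (by positivity) (hc0 s hs y)
    have h2 : β * s * (-M s) ≤ β * s * c s y :=
      mul_le_mul_of_nonneg_left (hcM s y) (by positivity)
    have h3 : α * m s x ≤ α * A := mul_le_mul_of_nonneg_left (hmA s x) hα.le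
    have h4 : 0 < α * m s x := mul_pos hα (hm0 s x)
    have h5 := hM0 s hs
    have h6 : 0 ≤ β * s * M s := by positivity
    rw [abs_le]
    constructor <;> simp only [E] <;> nlinarith
  have hδp : ∀ s (q : ℝ), 0 < δ s ^ q := fun s q => Real.rpow_pos_of_pos (hδ0 s) q
  have hl1 : ∀ s, 0 ≤ s → 1 ≤ l s ∧ δ s ^ (-p) * E s ≤ l s ∧
      p * δ s ^ (-p - 1) * E s + δ s ^ (-p) * (β * s + α) ≤ l s / 4 := by
    intro s hs
    have h1 := hE0 s hs
    have h2 := hδp s (-p)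
    have h3 := hδp s (-p - 1)
    have h4 : 0 ≤ δ s ^ (-p) * E s := by positivity
    have h5 : 0 ≤ p * δ s ^ (-p - 1) * E s + δ s ^ (-p) * (β * s + α) := by positivity
    simp only [l]
    refine ⟨?_, ?_, ?_⟩ <;> linarith
  have hhc : Continuous fun q : ℝ × ℝ × ℝ => h q.1 q.2.1 q.2.2 := by
    have h1 : Continuous fun q : ℝ × ℝ × ℝ => m q.1 q.2.1 := by fun_prop
    have h2 : Continuous fun q : ℝ × ℝ × ℝ => c q.1 q.2.2 := by fun_prop
    have h3 := h1.rpow_const (p := -p) fun q => Or.inl (hm0 q.1 q.2.1).ne'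
    exact h3.mul (by fun_prop)
  have hhb : ∀ s, 0 ≤ s → ∀ x y, |h s x y| ≤ l s := by
    intro s hs x y
    refine le_trans ?_ (hl1 s hs).2.1
    simp only [h]
    rw [abs_mul, abs_of_pos (hmr0 s x)]
    exact mul_le_mul (hmr s x) (hin s hs x y) (abs_nonneg _) (hδp s _).le
  have hhL : ∀ s, 0 ≤ s → ∀ x y x' y',
      |h s x y - h s x' y'| ≤ l s / 4 * (|x - x'| + |y - y'|) := by
    intro s hs x y x' y'
    have e : h s x y - h s x' y' = (m s x ^ (-p) - m s x' ^ (-p)) * (β * s * c s y + α * m s x)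
        + m s x' ^ (-p) * (β * s * (c s y - c s y') + α * (m s x - m s x')) := by
      simp only [h]
      ring
    have hmm : |m s x - m s x'| ≤ |x - x'| := abs_max_min_sub_max_min_le _ _ _ _
    have hcc : |c s y - c s y'| ≤ |y - y'| := abs_max_min_sub_max_min_le _ _ _ _
    have hE := hE0 s hs
    have hd1 := hδp s (-p)
    have hd2 := hδp s (-p - 1)
    have h1 : |m s x ^ (-p) - m s x' ^ (-p)| ≤ p * δ s ^ (-p - 1) * |x - x'| :=
      (abs_rpow_neg_sub_rpow_neg_le (by linarith) (hδ0 s) (hmδ s x) (hmδ s x')).trans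
        (by gcongr)
    have h2 : |β * s * (c s y - c s y') + α * (m s x - m s x')|
        ≤ β * s * |y - y'| + α * |x - x'| := by
      refine (abs_add_le _ _).trans ?_
      rw [abs_mul (β * s), abs_mul α, abs_of_pos hα, abs_of_nonneg (by positivity : 0 ≤ β * s)]
      gcongr
    rw [e]
    refine (abs_add_le _ _).trans ?_
    rw [abs_mul, abs_mul, abs_of_pos (hmr0 s x')]
    have hX := abs_nonneg (x - x')
    have hY := abs_nonneg (y - y')
    calc _ ≤ p * δ s ^ (-p - 1) * |x - x'| * E s
          + δ s ^ (-p) * (β * s * |y - y'| + α * |x - x'|) :=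
          add_le_add (mul_le_mul h1 (hin s hs x y) (abs_nonneg _) (by positivity))
            (mul_le_mul (hmr s x') h2 (abs_nonneg _) hd1.le)
      _ ≤ (p * δ s ^ (-p - 1) * E s + δ s ^ (-p) * (β * s + α)) * (|x - x'| + |y - y'|) := by
          have t1 : 0 ≤ p * δ s ^ (-p - 1) * E s * |y - y'| := by positivity
          have t2 : 0 ≤ δ s ^ (-p) * (β * s * |x - x'|) := by positivity
          have t3 : 0 ≤ δ s ^ (-p) * (α * |y - y'|) := by positivity
          linarith
      _ ≤ _ := mul_le_mul_of_nonneg_right (hl1 s hs).2.2 (by positivity)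
  obtain ⟨f, g, hgc, hf0, hfd, hg⟩ :=
    exists_radial_solution n A h hhc l hlc (fun s hs => (hl1 s hs).1) hhb hhL
  have hfc : Continuous f := continuous_iff_continuousAt.2 fun s => (hfd s).continuousAt
  have hkc : Continuous fun s => h s (f s) (g s) :=
    hhc.comp (continuous_id.prodMk (hfc.prodMk hgc))
  have hgd := fun s (hs : 0 < s) => hasDerivAt_of_eq_mul_integral n hkc hg hs
  have hg0 : ∀ s, 0 ≤ s → g s ≤ 0 := by
    intro s hs
    refine nonpos_of_deriv_nonpos_of_pos hs hgc.continuousOn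
      ((hg 0 le_rfl).trans_le (by rw [zero_mul, neg_zero]))
      fun x hx hgx => ⟨hgd x hx.1, ?_⟩
    have hcx : c x (g x) = 0 := by
      simp only [c, min_eq_right hgx.le]
      exact max_eq_right (by linarith [hM0 x hx.1.le])
    have h1 : 0 < h x (f x) (g x) := by
      simp only [h, hcx, mul_zero, zero_add]
      have := hm0 x (f x)
      have := hmr0 x (f x)
      positivity
    have h2 : 0 ≤ n * x⁻¹ * g x := by
      have := hx.1
      positivity
    linarith
  have hkb : ∀ s, 0 ≤ s → h s (f s) (g s) ≤ α * δ s ^ (1 - p) := by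
    intro s hs
    have h1 : β * s * c s (g s) ≤ 0 :=
      mul_nonpos_of_nonneg_of_nonpos (by positivity) (hc0 s hs _)
    have h2 : m s (f s) ^ (-p) * m s (f s) = m s (f s) ^ (1 - p) := by
      rw [← Real.rpow_add_one (hm0 s _).ne']
      ring_nf
    have h3 : m s (f s) ^ (1 - p) ≤ δ s ^ (1 - p) :=
      Real.rpow_le_rpow_of_nonpos (hδ0 s) (hmδ s _) (by linarith)
    have h4 := hmr0 s (f s)
    calc h s (f s) (g s) ≤ m s (f s) ^ (-p) * (α * m s (f s)) :=
          mul_le_mul_of_nonneg_left (by linarith) h4.le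
      _ = α * m s (f s) ^ (1 - p) := by rw [← h2]; ring
      _ ≤ _ := by gcongr
  have hgM : ∀ s, 0 ≤ s → -M s ≤ g s := by
    intro s hs
    rw [hg s hs, neg_le_neg_iff]
    have h1 : ∫ t in (0:ℝ)..1, t ^ n * h (t * s) (f (t * s)) (g (t * s)) ≤
        ∫ t in (0:ℝ)..1, α * δ s ^ (1 - p) := by
      refine intervalIntegral.integral_mono_on zero_le_one ?_ (by simp) fun t ht => ?_
      · exact ((continuous_id.pow n).mul
          (hkc.comp (continuous_id.mul continuous_const))).intervalIntegrable _ _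
      · have hts : 0 ≤ t * s := mul_nonneg ht.1 hs
        have h2 : δ (t * s) ^ (1 - p) ≤ δ s ^ (1 - p) :=
          Real.rpow_le_rpow_of_nonpos (hδ0 s) (hδa (mul_le_of_le_one_left hs ht.2))
            (by linarith)
        have h3 : h (t * s) (f (t * s)) (g (t * s)) ≤ α * δ s ^ (1 - p) :=
          (hkb _ hts).trans (by gcongr)
        have h4 := hδp s (1 - p)
        calc _ ≤ t ^ n * (α * δ s ^ (1 - p)) :=
              mul_le_mul_of_nonneg_left h3 (pow_nonneg ht.1 n)
          _ ≤ 1 * (α * δ s ^ (1 - p)) :=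
              mul_le_mul_of_nonneg_right (pow_le_one₀ ht.1 ht.2) (by positivity)
          _ = _ := one_mul _
    simp only [intervalIntegral.integral_const, sub_zero, one_smul] at h1
    calc _ ≤ s * (α * δ s ^ (1 - p)) := mul_le_mul_of_nonneg_left h1 hs
      _ = M s := by simp only [M]; ring
  have hfA : ∀ s, 0 ≤ s → f s ≤ A := by
    intro s hs
    have := nonpos_of_deriv_nonpos_of_pos (φ := fun x => f x - A) (φ' := g) hs
      (by fun_prop) (by simp [hf0]) fun x hx _ => ⟨(hfd x).sub_const A, hg0 x hx.1.le⟩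
    linarith
  refine ⟨f, g, hgc, hf0, hfd, fun s hs => ⟨hgM s hs, hg0 s hs, hfA s hs⟩, fun s hs hδf => ?_⟩
  refine (hgd s hs).congr_deriv ?_
  have hms : m s (f s) = f s := by
    simp only [m, min_eq_left (hfA s hs.le), max_eq_right hδf]
  have hcs : c s (g s) = g s := by
    simp only [c, min_eq_left (hg0 s hs.le), max_eq_right (hgM s hs.le)]
  simp only [h, hms, hcs]

theorem mul_le_log_one_add_mul {A L R x : ℝ} (hA : 0 < A) (hL : 0 < L)
    (hR : R ≤ Real.log (1 + L * A)) (hx : 0 ≤ x) (hxA : x ≤ A) :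
    x / A * R ≤ Real.log (1 + L * x) := by
  have hxA0 : 0 ≤ x / A := by positivity
  have h1 := rpow_one_add_le_one_add_mul_self (s := L * A) (by nlinarith) hxA0
    ((div_le_one hA).2 hxA)
  have e : x / A * (L * A) = L * x := by field_simp
  rw [e] at h1
  have h2 := Real.log_le_log (Real.rpow_pos_of_pos (by positivity) _) h1
  rw [Real.log_rpow (by positivity)] at h2
  exact (mul_le_mul_of_nonneg_left hR hxA0).trans h2

/-- The damping term dominates along the logarithmic barrier. -/
theorem barrier_deriv_nonpos {p α β A L R c s₁ s x y ν : ℝ} (hp : 1 ≤ p) (hβ : 0 < β)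
    (hA : 0 < A) (hL : 0 < L) (hR : R ≤ Real.log (1 + L * A)) (hs₁ : 0 < s₁) (hs : s₁ ≤ s)
    (hx : 0 < x) (hxA : x ≤ A) (hc : c = β * s₁ / 2 * A ^ (1 - p))
    (hcR : α * A ≤ β * s₁ / 2 * (c * R)) (hν : 0 ≤ ν) (hy : 0 < -y - c * Real.log (1 + L * x)) :
    -(-(ν * s⁻¹ * y) - x ^ (-p) * (β * s * y + α * x)) - c * (L * y / (1 + L * x)) ≤ 0 := by
  have hb : 0 < β * s₁ / 2 := by positivity
  have hs0 : 0 < s := hs₁.trans_le hs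
  have hc0 : 0 < c := by rw [hc]; positivity
  have hq : 0 < x ^ (-p) := Real.rpow_pos_of_pos hx _
  have hlog0 : 0 < Real.log (1 + L * x) := Real.log_pos (by nlinarith [mul_pos hL hx])
  have hy0 : y < 0 := by nlinarith [mul_pos hc0 hlog0]
  have hlog := mul_le_log_one_add_mul hA hL hR hx.le hxA
  have h1 : c ≤ β * s₁ / 2 * (x ^ (-p) * x) := by
    rw [hc, ← Real.rpow_add_one hx.ne']
    refine mul_le_mul_of_nonneg_left ?_ hb.le
    rw [show -p + 1 = 1 - p by ring]
    exact Real.rpow_le_rpow_of_nonpos hx hxA (by linarith)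
  have h2 : c * (L / (1 + L * x)) ≤ β * s₁ / 2 * x ^ (-p) := by
    rw [← mul_div_assoc, div_le_iff₀ (by positivity)]
    nlinarith [mul_le_mul_of_nonneg_right h1 hL.le, mul_pos hb hq]
  have h3 : α * x ≤ β * s₁ / 2 * (c * Real.log (1 + L * x)) := by
    calc α * x = x / A * (α * A) := by field_simp
      _ ≤ x / A * (β * s₁ / 2 * (c * R)) := by gcongr
      _ = β * s₁ / 2 * (c * (x / A * R)) := by ring
      _ ≤ _ := by gcongr
  have h4 : ν * s⁻¹ * y ≤ 0 := mul_nonpos_of_nonneg_of_nonpos (by positivity) hy0.le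
  have h5 : c * (L / (1 + L * x)) * (-y) ≤ β * s₁ / 2 * x ^ (-p) * (-y) :=
    mul_le_mul_of_nonneg_right h2 (by linarith)
  have h6 : β * s * y ≤ β * s₁ * y :=
    mul_le_mul_of_nonpos_right (mul_le_mul_of_nonneg_left hs hβ.le) hy0.le
  have h7 : β * s * y + α * x - β * s₁ / 2 * y ≤ 0 := by nlinarith
  have h8 := mul_nonpos_of_nonneg_of_nonpos hq.le h7
  have e : c * (L * y / (1 + L * x)) = -(c * (L / (1 + L * x)) * (-y)) := by ring
  rw [e]
  linarith

theorem exists_profile (n : ℕ) {p α β A : ℝ} (hp : 1 ≤ p) (hα : 0 < α) (hβ : 0 < β)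
    (hA : 0 < A) :
    ∃ f g : ℝ → ℝ, Continuous g ∧ f 0 = A ∧ (∀ s, HasDerivAt f (g s) s) ∧ g 0 = 0 ∧
      (∀ s, 0 ≤ s → 0 < f s ∧ g s ≤ 0) ∧
      ∀ s, 0 < s →
        HasDerivAt g (-(n * s⁻¹ * g s) - f s ^ (-p) * (β * s * g s + α * f s)) s := by
  obtain ⟨B, hB⟩ : ∃ B, B = (A / 4) ^ (1 - p) := ⟨_, rfl⟩
  have hB0 : 0 < B := hB ▸ Real.rpow_pos_of_pos (by positivity) _
  obtain ⟨s₁, hs₁, hs₁A⟩ : ∃ s₁ : ℝ, 0 < s₁ ∧ α * s₁ * B * s₁ = A / 2 := by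
    refine ⟨√(A / (2 * (α * B))), by positivity, ?_⟩
    have := Real.mul_self_sqrt (show 0 ≤ A / (2 * (α * B)) by positivity)
    calc _ = α * B * (√(A / (2 * (α * B))) * √(A / (2 * (α * B)))) := by ring
      _ = A / 2 := by rw [this]; field_simp
  obtain ⟨c, hc⟩ : ∃ c, c = β * s₁ / 2 * A ^ (1 - p) := ⟨_, rfl⟩
  have hc0 : 0 < c := by rw [hc]; positivity
  obtain ⟨R, hR1, hR2⟩ : ∃ R, α * s₁ * B ≤ c * R ∧ α * A ≤ β * s₁ / 2 * (c * R) := by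
    refine ⟨max (α * s₁ * B / c) (α * A / (β * s₁ / 2 * c)), ?_, ?_⟩
    · rw [← div_le_iff₀' hc0]
      exact le_max_left _ _
    · rw [← mul_assoc, ← div_le_iff₀' (by positivity)]
      exact le_max_right _ _
  obtain ⟨L, hL⟩ : ∃ L, L = 2 / A * Real.exp R := ⟨_, rfl⟩
  have hL0 : 0 < L := by rw [hL]; positivity
  have hRL : ∀ x, A / 2 ≤ x → R ≤ Real.log (1 + L * x) := by
    intro x hx
    have hx0 : 0 < x := lt_of_lt_of_le (by positivity) hx
    rw [Real.le_log_iff_exp_le (by positivity)]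
    have : L * (A / 2) = Real.exp R := by rw [hL]; field_simp
    nlinarith
  set δ : ℝ → ℝ := fun s => A / 4 * Real.exp (-(c * L * max (s - s₁) 0)) with hδ
  have hδ1 : ∀ s, s ≤ s₁ → δ s = A / 4 := fun s hs => by
    simp [hδ, max_eq_right (sub_nonpos.2 hs)]
  have hδA : ∀ s, δ s ≤ A / 4 := fun s => by
    refine mul_le_of_le_one_right (by positivity) (Real.exp_le_one_iff.2 ?_)
    have := le_max_right (s - s₁) 0
    have : 0 ≤ c * L * max (s - s₁) 0 := by positivity
    linarith
  have hδ0 : ∀ s, 0 < δ s := fun s => by positivity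
  have hδc : Continuous δ := by fun_prop
  have hδa : Antitone δ := fun s t hst => by
    simp only [hδ]
    gcongr
  obtain ⟨f, g, hgc, hf0, hfd, hgb, hgd⟩ := exists_truncated_profile n hp hα hβ hA hδc hδa hδ0
    (fun s => (hδA s).trans (by linarith))
  have hfc : Continuous f := continuous_iff_continuousAt.2 fun s => (hfd s).continuousAt
  have hnear : ∀ s, 0 ≤ s → s ≤ s₁ → A / 2 ≤ f s := by
    intro s hs hss
    have := nonpos_of_deriv_nonpos_of_pos (φ := fun x => A - α * s₁ * B * x - f x)
      (φ' := fun x => 0 - α * s₁ * B * 1 - g x) hs (by fun_prop) (by simp [hf0]) fun x hx _ => by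
        refine ⟨(((hasDerivAt_const x A).sub ((hasDerivAt_id x).const_mul _))).sub (hfd x), ?_⟩
        have h1 := (hgb x hx.1.le).1
        rw [hδ1 x (hx.2.le.trans hss), ← hB] at h1
        have h2 : α * x * B ≤ α * s₁ * B := by
          have := hx.2.le.trans hss
          gcongr
        linarith
    have h3 : α * s₁ * B * s ≤ α * s₁ * B * s₁ := by gcongr
    linarith
  have hfar : ∀ s, s₁ ≤ s → δ s < f s := by
    by_contra! hcon
    obtain ⟨b, hb, hfb⟩ := hcon
    have hK : IsCompact (Set.Icc s₁ b ∩ {s | f s ≤ δ s}) :=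
      isCompact_Icc.inter_right (isClosed_le hfc hδc)
    obtain ⟨r, ⟨hr1, hr2⟩, hmin⟩ := hK.exists_isLeast ⟨b, ⟨hb, le_rfl⟩, hfb⟩
    have hbelow : ∀ x, s₁ ≤ x → x < r → δ x < f x := by
      intro x hx hxr
      by_contra! hx0
      exact absurd (hmin ⟨⟨hx, hxr.le.trans hr1.2⟩, hx0⟩) (not_le.2 hxr)
    have hbar : ∀ x, s₁ ≤ x → x < r → -(c * L * f x) ≤ g x := by
      intro x hx hxr
      have hf : ∀ t ∈ Set.Icc s₁ x, 0 < f t := fun t ht =>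
        (hδ0 t).trans (hbelow t ht.1 (ht.2.trans_lt hxr))
      have := nonpos_of_deriv_nonpos_of_pos (φ := fun t => -g t - c * Real.log (1 + L * f t))
        (φ' := fun t => -(-(n * t⁻¹ * g t) - f t ^ (-p) * (β * t * g t + α * f t))
          - c * (L * g t / (1 + L * f t))) hx
        (by
          refine hgc.neg.continuousOn.sub (continuousOn_const.mul (ContinuousOn.log ?_ ?_))
          · fun_prop
          · intro t ht
            have := hf t ht
            positivity)
        (by
          have h1 := (hgb s₁ hs₁.le).1
          rw [hδ1 s₁ le_rfl, ← hB] at h1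
          have h2 := mul_le_mul_of_nonneg_left (hRL _ (hnear s₁ hs₁.le le_rfl)) hc0.le
          linarith)
        (fun t ht htp => by
          have hft := hf t ⟨ht.1.le, ht.2.le⟩
          have ht0 : 0 < t := hs₁.trans ht.1
          refine ⟨?_, barrier_deriv_nonpos hp hβ hA hL0 (hRL A (by linarith)) hs₁ ht.1.le hft
            (hgb t ht0.le).2.2 hc hR2 (Nat.cast_nonneg n) htp⟩
          exact (hgd t ht0 (hbelow t ht.1.le (ht.2.trans hxr)).le).neg.sub
            (((((hfd t).const_mul L).const_add 1).log (by positivity)).const_mul c))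
      have hfx := hf x ⟨hx, le_rfl⟩
      have h2 := Real.log_le_sub_one_of_pos (show 0 < 1 + L * f x by positivity)
      have h3 := mul_le_mul_of_nonneg_left h2 hc0.le
      linarith
    have := nonpos_of_deriv_nonpos_of_pos
      (φ := fun t => A / 2 - f t * Real.exp (c * L * (t - s₁)))
      (φ' := fun t => -(g t * Real.exp (c * L * (t - s₁))
        + f t * (Real.exp (c * L * (t - s₁)) * (c * L * 1)))) hr1.1 (by fun_prop)
      (by simpa using hnear s₁ hs₁.le le_rfl)
      (fun t ht _ => by
        refine ⟨((hfd t).mul ((((hasDerivAt_id t).sub_const s₁).const_mul (c * L)).exp)).const_sub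
          _, ?_⟩
        have h1 := hbar t ht.1.le ht.2
        have h2 := Real.exp_pos (c * L * (t - s₁))
        nlinarith)
    have hexp : δ r * Real.exp (c * L * (r - s₁)) = A / 4 := by
      simp only [hδ, max_eq_left (sub_nonneg.2 hr1.1)]
      rw [mul_assoc, ← Real.exp_add]
      simp
    have hle : f r * Real.exp (c * L * (r - s₁)) ≤ δ r * Real.exp (c * L * (r - s₁)) :=
      mul_le_mul_of_nonneg_right hr2 (Real.exp_pos _).le
    linarith
  have hall : ∀ s, 0 ≤ s → δ s < f s := by
    intro s hs
    rcases le_total s s₁ with h | h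
    · have := hnear s hs h
      have := hδA s
      linarith
    · exact hfar s h
  refine ⟨f, g, hgc, hf0, hfd, ?_, fun s hs => ⟨(hδ0 s).trans (hall s hs), (hgb s hs).2.1⟩,
    fun s hs => hgd s hs (hall s hs.le).le⟩
  have h1 := hgb 0 le_rfl
  refine le_antisymm h1.2.1 ?_
  simpa using h1.1

/-- Lemma (global existence for the profile ODE): for `p ≥ 1`, `α, β, A > 0` there is a
globally defined `f ∈ C¹([0,∞)) ∩ C²((0,∞))` with `f(0) = A`, `f'(0) = 0`, solving
`fᵖ(f'' + (n-1)ξ⁻¹ f') + βξf' + αf = 0` on `(0,∞)`, which is positive and nonincreasing. -/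
theorem stmt17 (n : ℕ) (hn : 1 ≤ n) (p α β A : ℝ) (hp : 1 ≤ p) (hα : 0 < α)
    (hβ : 0 < β) (hA : 0 < A) :
    ∃ f : ℝ → ℝ,
      ContDiffOn ℝ 1 f (Set.Ici 0) ∧ ContDiffOn ℝ 2 f (Set.Ioi 0) ∧
      f 0 = A ∧ derivWithin f (Set.Ici 0) 0 = 0 ∧
      (∀ ξ : ℝ, 0 < ξ →
        f ξ ^ p * (deriv (deriv f) ξ + ((n : ℝ) - 1) * ξ⁻¹ * deriv f ξ)
          + β * ξ * deriv f ξ + α * f ξ = 0) ∧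
      (∀ ξ : ℝ, 0 ≤ ξ → 0 < f ξ) ∧
      (∀ ξ : ℝ, 0 ≤ ξ → derivWithin f (Set.Ici 0) ξ ≤ 0) := by
  obtain ⟨n, rfl⟩ : ∃ m, n = m + 1 := ⟨n - 1, by omega⟩
  obtain ⟨f, g, hgc, hf0, hfd, hg0, hfg, hgd⟩ := exists_profile n hp hα hβ hA
  have hdf : deriv f = g := funext fun s => (hfd s).deriv
  have hfdiff : Differentiable ℝ f := fun s => (hfd s).differentiableAt
  have hdw : ∀ s, 0 ≤ s → derivWithin f (Set.Ici 0) s = g s := fun s hs =>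
    (hfd s).hasDerivWithinAt.derivWithin (uniqueDiffOn_Ici 0 s hs)
  have hg1 : ContDiffOn ℝ 1 g (Set.Ioi 0) := by
    rw [show (1 : WithTop ℕ∞) = 0 + 1 by norm_num, contDiffOn_succ_iff_deriv_of_isOpen isOpen_Ioi]
    refine ⟨fun s hs => (hgd s hs).differentiableAt.differentiableWithinAt, by simp, ?_⟩
    rw [contDiffOn_zero]
    have hcont : ContinuousOn (fun s => -(n * s⁻¹ * g s) - f s ^ (-p) * (β * s * g s + α * f s))
        (Set.Ioi 0) := by
      have hfc := hfdiff.continuous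
      have h1 : ContinuousOn (fun s : ℝ => s⁻¹) (Set.Ioi 0) :=
        continuousOn_inv₀.mono fun s hs => ne_of_gt hs
      have h2 : ContinuousOn (fun s => f s ^ (-p)) (Set.Ioi 0) :=
        hfc.continuousOn.rpow_const fun s hs => Or.inl (hfg s (le_of_lt hs)).1.ne'
      fun_prop
    exact hcont.congr fun s hs => (hgd s hs).deriv
  refine ⟨f, ?_, ?_, hf0, ?_, fun s hs => ?_, fun s hs => (hfg s hs).1, fun s hs => ?_⟩
  · refine ContDiff.contDiffOn (contDiff_one_iff_deriv.2 ⟨hfdiff, ?_⟩)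
    rwa [hdf]
  · rw [show (2 : WithTop ℕ∞) = 1 + 1 by norm_num, contDiffOn_succ_iff_deriv_of_isOpen isOpen_Ioi]
    refine ⟨hfdiff.differentiableOn, by simp, ?_⟩
    rwa [hdf]
  · rw [hdw 0 le_rfl, hg0]
  · rw [hdf, (hgd s hs).deriv]
    have h1 := (hfg s hs.le).1
    have h2 : f s ^ p * f s ^ (-p) = 1 := by
      rw [← Real.rpow_add h1]
      simp
    push_cast
    linear_combination (-(β * s * g s + α * f s)) * h2
  · rw [hdw s hs]
    exact (hfg s hs).2
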